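/- arXiv:2108.02884 — 2 statements merged into one kernel-verified Lean document; each statement's English description precedes it below -/
import Mathlib

section
/- Let G be a group generated by three elements g₁, g₂, g₃. Then the kernel of Φ_G equals the ideal I_G of ℂ[x₁, x₂, x₃, x₁₂, x₁₃, x₂₃, x₁₂₃] generated by K together with all differences P − Q of polynomials P, Q for which there exist u, v ∈ F₃ with ι(u) = ι(v), Φ(P) = [u], and Φ(Q) = [v]. Consequently S(G;ℂ) is isomorphic as a ℂ-algebra to ℂ[x₁, x₂, x₃, x₁₂, x₁₃, x₂₃, x₁₂₃]/I_G. -/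
open MvPolynomial

noncomputable section

def skeinIdeal (R G : Type*) [CommRing R] [Group G] : Ideal (MvPolynomial G R) :=
  Ideal.span ({X (1 : G) - 2} ∪
    {p | ∃ g h : G, p = X g * X h - X (g * h) - X (g * h⁻¹)})

abbrev SkeinAlgebra (R G : Type*) [CommRing R] [Group G] :=
  MvPolynomial G R ⧸ skeinIdeal R G

def cl (R : Type*) {G : Type*} [CommRing R] [Group G] (g : G) : SkeinAlgebra R G :=
  Ideal.Quotient.mk (skeinIdeal R G) (X g)

/-- The free group on three generators. -/
abbrev F3 := FreeGroup (Fin 3)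

def g1 : F3 := FreeGroup.of 0
def g2 : F3 := FreeGroup.of 1
def g3 : F3 := FreeGroup.of 2

/-- The words `g₁, g₂, g₃, g₁g₂, g₁g₃, g₂g₃, g₁g₂g₃` indexed by the seven variables
`x₁, x₂, x₃, x₁₂, x₁₃, x₂₃, x₁₂₃`. -/
def word : Fin 7 → F3 := ![g1, g2, g3, g1 * g2, g1 * g3, g2 * g3, g1 * g2 * g3]

/-- `Φ : ℂ[x₁,…,x₁₂₃] → S(F₃;ℂ)`, `x_{i₁⋯i_k} ↦ [g_{i₁}⋯g_{i_k}]`. -/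
def Phi : MvPolynomial (Fin 7) ℂ →ₐ[ℂ] SkeinAlgebra ℂ F3 :=
  aeval fun i => cl ℂ (word i)

-- the seven variables
def x1 : MvPolynomial (Fin 7) ℂ := X 0
def x2 : MvPolynomial (Fin 7) ℂ := X 1
def x3 : MvPolynomial (Fin 7) ℂ := X 2
def x12 : MvPolynomial (Fin 7) ℂ := X 3
def x13 : MvPolynomial (Fin 7) ℂ := X 4
def x23 : MvPolynomial (Fin 7) ℂ := X 5
def x123 : MvPolynomial (Fin 7) ℂ := X 6

/-- The polynomial `K`. -/
def K : MvPolynomial (Fin 7) ℂ :=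
  x123 ^ 2 - (x12 * x3 + x13 * x2 + x23 * x1 - x1 * x2 * x3) * x123
    + x1 ^ 2 + x2 ^ 2 + x3 ^ 2 + x12 ^ 2 + x23 ^ 2 + x13 ^ 2
    - x1 * x2 * x12 - x1 * x3 * x13 - x2 * x3 * x23 + x12 * x13 * x23 - 4

namespace SkeinAlgebra

variable {R G : Type*} [CommRing R] [Group G]

theorem cl_one : cl R (1 : G) = 2 := by
  have h : Ideal.Quotient.mk (skeinIdeal R G) (X 1 - 2) = 0 :=
    Ideal.Quotient.eq_zero_iff_mem.2 (Ideal.subset_span (Or.inl rfl))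
  rwa [map_sub, sub_eq_zero, map_ofNat] at h

theorem cl_mul_cl (g h : G) : cl R g * cl R h = cl R (g * h) + cl R (g * h⁻¹) := by
  have h : Ideal.Quotient.mk (skeinIdeal R G) (X g * X h - X (g * h) - X (g * h⁻¹)) = 0 :=
    Ideal.Quotient.eq_zero_iff_mem.2 (Ideal.subset_span (Or.inr ⟨g, h, rfl⟩))
  rw [map_sub, map_sub, map_mul, sub_sub, sub_eq_zero] at h
  exact h

theorem cl_inv (g : G) : cl R g⁻¹ = cl R g := by
  have h := cl_mul_cl (R := R) 1 g
  rw [cl_one, one_mul, one_mul] at h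
  linear_combination -h

theorem cl_mul_comm (g h : G) : cl R (g * h) = cl R (h * g) := by
  have h₁ := cl_mul_cl (R := R) g h
  have h₂ := cl_mul_cl (R := R) h g
  have h₃ := cl_inv (R := R) (g * h⁻¹)
  rw [mul_inv_rev, inv_inv] at h₃
  linear_combination h₂ - h₁ + h₃

theorem cl_insert_inv (a g b : G) :
    cl R (a * g⁻¹ * b) = cl R g * cl R (a * b) - cl R (a * g * b) := by
  have h := cl_mul_cl (R := R) (b * a) g
  rw [cl_mul_comm b a, mul_assoc b, cl_mul_comm b, mul_assoc b, cl_mul_comm b] at h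
  linear_combination -h

theorem cl_insert_sq (a g b : G) :
    cl R (a * g * g * b) = cl R g * cl R (a * g * b) - cl R (a * b) := by
  have h := cl_insert_inv (R := R) (a * g) g b
  rw [mul_inv_cancel_right] at h
  linear_combination h

theorem cl_insert_swap (a g h b : G) :
    cl R (a * h * g * b) = -cl R (a * g * h * b) + cl R h * cl R (a * g * b)
      + cl R g * cl R (a * h * b) + (cl R (g * h) - cl R g * cl R h) * cl R (a * b) := by
  have h₁ := cl_insert_inv (R := R) a (g * h) b
  have h₂ := cl_insert_inv (R := R) (a * h⁻¹) g b
  have h₃ := cl_insert_inv (R := R) a h b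
  have h₄ := cl_insert_inv (R := R) a h (g * b)
  simp only [mul_inv_rev, ← mul_assoc] at h₁ h₂ h₃ h₄
  linear_combination h₁ - h₂ - cl R g * h₃ + h₄

/-- The function `y ↦ [w y]`. -/
def leftTrans (R : Type*) [CommRing R] (w : G) : G → SkeinAlgebra R G := fun y => cl R (w * y)

section Span

variable {A : Subalgebra R (SkeinAlgebra R G)} {M : Submodule A (G → SkeinAlgebra R G)}

theorem leftTrans_sq_mem {a g b : G} (hg : cl R g ∈ A) (h₁ : leftTrans R (a * g * b) ∈ M)
    (h₂ : leftTrans R (a * b) ∈ M) : leftTrans R (a * g * g * b) ∈ M := by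
  have h : leftTrans R (a * g * g * b) =
      (⟨cl R g, hg⟩ : A) • leftTrans R (a * g * b) - leftTrans R (a * b) := by
    funext y
    simpa [leftTrans, mul_assoc, Subalgebra.smul_def] using cl_insert_sq (R := R) a g (b * y)
  rw [h]
  exact sub_mem (M.smul_mem _ h₁) h₂

theorem leftTrans_inv_mem {g w : G} (hg : cl R g ∈ A) (h₁ : leftTrans R (g * w) ∈ M)
    (h₂ : leftTrans R w ∈ M) : leftTrans R (g⁻¹ * w) ∈ M := by
  have h : leftTrans R (g⁻¹ * w) =
      (⟨cl R g, hg⟩ : A) • leftTrans R w - leftTrans R (g * w) := by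
    funext y
    simpa [leftTrans, mul_assoc, Subalgebra.smul_def] using cl_insert_inv (R := R) 1 g (w * y)
  rw [h]
  exact sub_mem (M.smul_mem _ h₂) h₁

theorem leftTrans_swap_mem {a g h b : G} (hg : cl R g ∈ A) (hh : cl R h ∈ A)
    (hgh : cl R (g * h) ∈ A) (h₁ : leftTrans R (a * g * h * b) ∈ M)
    (h₂ : leftTrans R (a * g * b) ∈ M) (h₃ : leftTrans R (a * h * b) ∈ M)
    (h₄ : leftTrans R (a * b) ∈ M) : leftTrans R (a * h * g * b) ∈ M := by
  have e : leftTrans R (a * h * g * b) =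
      -leftTrans R (a * g * h * b) + (⟨cl R h, hh⟩ : A) • leftTrans R (a * g * b)
        + (⟨cl R g, hg⟩ : A) • leftTrans R (a * h * b)
        + (⟨cl R (g * h), hgh⟩ - ⟨cl R g, hg⟩ * ⟨cl R h, hh⟩ : A) • leftTrans R (a * b) := by
    funext y
    simpa [leftTrans, mul_assoc, Subalgebra.smul_def] using
      cl_insert_swap (R := R) a g h (b * y)
  rw [e]
  exact add_mem (add_mem (add_mem (neg_mem h₁) (M.smul_mem _ h₂)) (M.smul_mem _ h₃))
    (M.smul_mem _ h₄)

/-- If the span of the functions `y ↦ [m y]`, `m ∈ s`, contains `y ↦ [g m y]` for all `m ∈ s`,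
then it is stable under left translation by `g`. -/
theorem leftTrans_mul_mem {s : Set G} {g : G}
    (hs : ∀ m ∈ s, leftTrans R (g * m) ∈ Submodule.span A (leftTrans R '' s)) {w : G}
    (hw : leftTrans R w ∈ Submodule.span A (leftTrans R '' s)) :
    leftTrans R (g * w) ∈ Submodule.span A (leftTrans R '' s) := by
  have e (m : G) : LinearMap.funLeft A (SkeinAlgebra R G) (· * g) (leftTrans R m) =
      leftTrans R (g * m) := by
    funext y
    simp only [LinearMap.funLeft_apply, leftTrans]
    rw [← mul_assoc, cl_mul_comm, mul_assoc g]
  rw [← e]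
  refine (Submodule.map_span_le _ _ _).2 ?_ (Submodule.mem_map_of_mem hw)
  rintro _ ⟨m, hm, rfl⟩
  rw [e]
  exact hs m hm

end Span

/-- The trace relation on three elements: `[abc]` is a root of the monic quadratic polynomial
whose other root is `[acb]`. -/
theorem cl_triple_quadratic (a b c : G) :
    cl R (a * b * c) ^ 2 - (cl R (a * b) * cl R c + cl R (a * c) * cl R b + cl R (b * c) * cl R a
        - cl R a * cl R b * cl R c) * cl R (a * b * c)
      + cl R a ^ 2 + cl R b ^ 2 + cl R c ^ 2 + cl R (a * b) ^ 2 + cl R (b * c) ^ 2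
      + cl R (a * c) ^ 2 - cl R a * cl R b * cl R (a * b) - cl R a * cl R c * cl R (a * c)
      - cl R b * cl R c * cl R (b * c) + cl R (a * b) * cl R (a * c) * cl R (b * c) - 4 = 0 := by
  have sq (g : G) : cl R (g * g) = cl R g ^ 2 - 2 := by
    have h := cl_mul_cl (R := R) g g
    rw [mul_inv_cancel, cl_one] at h
    linear_combination -h
  have quot (g h : G) : cl R (g * h⁻¹) = cl R g * cl R h - cl R (g * h) := by
    rw [cl_mul_cl, add_sub_cancel_left]
  have conj (g h : G) : cl R (g * h * g⁻¹) = cl R h := by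
    rw [cl_mul_comm, inv_mul_cancel_left]
  have sum := cl_insert_swap (R := R) a b c 1
  have prod := cl_mul_cl (R := R) (a * b * c) (a * c * b)
  have comm := cl_mul_cl (R := R) (b * c * b⁻¹) c
  have comm' := cl_mul_cl (R := R) (b * c) (b⁻¹ * c)
  have rot := cl_mul_comm (R := R) (a * b) (c * a * c * b)
  have cacb := cl_mul_cl (R := R) (c * a) (c * b * a * b)
  have abab := cl_mul_cl (R := R) (a * b⁻¹) (a⁻¹ * b⁻¹)
  have cbab := cl_mul_cl (R := R) (c * b) (a * b)
  have conj₁ := conj a (b * c * b⁻¹ * c⁻¹)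
  have conj₂ := conj c (a * b⁻¹ * a⁻¹ * b⁻¹)
  have inv_ba := cl_inv (R := R) (b * a)
  rw [conj] at comm
  simp only [mul_assoc, mul_inv_rev, inv_inv, mul_one, inv_mul_cancel_left,
    mul_inv_cancel_left] at *
  rw [cl_mul_comm b⁻¹ c, quot, cl_mul_comm c b, sq] at comm'
  rw [inv_ba, quot, cl_mul_comm b a, sq] at abab
  rw [quot, cl_mul_comm c a, cl_mul_comm c b] at cbab
  rw [cl_mul_comm c a] at cacb
  linear_combination cl R (a * (b * c)) * sum - prod - conj₁ + comm - comm' - rot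
    + cacb + conj₂ - abab + cl R (a * c) * cbab

/-- The universal property of the skein algebra. -/
def lift {B : Type*} [CommRing B] [Algebra R B] (f : G → B) (h₁ : f 1 = 2)
    (hmul : ∀ a b, f a * f b = f (a * b) + f (a * b⁻¹)) : SkeinAlgebra R G →ₐ[R] B :=
  Ideal.Quotient.liftₐ (skeinIdeal R G) (aeval f) fun x hx => by
    have hle : skeinIdeal R G ≤ RingHom.ker (aeval f : MvPolynomial G R →ₐ[R] B) := by
      refine Ideal.span_le.2 ?_
      rintro _ (rfl | ⟨a, b, rfl⟩)
      · simp [RingHom.mem_ker, h₁]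
      · simp [RingHom.mem_ker, hmul]
    exact hle hx

theorem lift_cl {B : Type*} [CommRing B] [Algebra R B] (f : G → B) (h₁ : f 1 = 2)
    (hmul : ∀ a b, f a * f b = f (a * b) + f (a * b⁻¹)) (g : G) :
    lift (R := R) f h₁ hmul (cl R g) = f g :=
  aeval_X f g

/-- The map of skein algebras induced by a group homomorphism. -/
def mapHom {H : Type*} [Group H] (f : G →* H) : SkeinAlgebra R G →ₐ[R] SkeinAlgebra R H :=
  lift (fun g => cl R (f g)) (by rw [map_one, cl_one]) fun a b => by
    rw [cl_mul_cl, map_mul, map_mul, map_inv]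

theorem mapHom_cl {H : Type*} [Group H] (f : G →* H) (g : G) :
    mapHom f (cl R g) = cl R (f g) :=
  lift_cl ..

theorem eq_top_of_cl_mem {A : Subalgebra R (SkeinAlgebra R G)} (h : ∀ g, cl R g ∈ A) :
    A = ⊤ := by
  refine eq_top_iff.2 fun x _ => ?_
  obtain ⟨P, rfl⟩ := Ideal.Quotient.mk_surjective x
  induction P using MvPolynomial.induction_on with
  | C r => exact A.algebraMap_mem r
  | add P Q hP hQ =>
    exact map_add (Ideal.Quotient.mk (skeinIdeal R G)) P Q ▸
      A.add_mem (hP trivial) (hQ trivial)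
  | mul_X P g hP =>
    exact map_mul (Ideal.Quotient.mk (skeinIdeal R G)) P _ ▸
      A.mul_mem (hP trivial) (h g)

end SkeinAlgebra

open SkeinAlgebra

theorem leftTrans_mem_span_word {A : Subalgebra ℂ (SkeinAlgebra ℂ F3)}
    (hA : ∀ i, cl ℂ (word i) ∈ A) (w : F3) :
    leftTrans ℂ w ∈ Submodule.span A (leftTrans ℂ '' insert 1 (Set.range word)) := by
  set M := Submodule.span A (leftTrans ℂ '' insert 1 (Set.range word)) with hM
  have a1 : cl ℂ g1 ∈ A := hA 0
  have a2 : cl ℂ g2 ∈ A := hA 1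
  have a3 : cl ℂ g3 ∈ A := hA 2
  have a12 : cl ℂ (g1 * g2) ∈ A := hA 3
  have a13 : cl ℂ (g1 * g3) ∈ A := hA 4
  have a23 : cl ℂ (g2 * g3) ∈ A := hA 5
  have m (i : Fin 7) : leftTrans ℂ (word i) ∈ M :=
    Submodule.subset_span ⟨_, Or.inr ⟨i, rfl⟩, rfl⟩
  have m0 : leftTrans ℂ (1 : F3) ∈ M := Submodule.subset_span ⟨_, Or.inl rfl, rfl⟩
  have m1 : leftTrans ℂ g1 ∈ M := m 0
  have m2 : leftTrans ℂ g2 ∈ M := m 1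
  have m3 : leftTrans ℂ g3 ∈ M := m 2
  have m12 : leftTrans ℂ (g1 * g2) ∈ M := m 3
  have m13 : leftTrans ℂ (g1 * g3) ∈ M := m 4
  have m23 : leftTrans ℂ (g2 * g3) ∈ M := m 5
  have m123 : leftTrans ℂ (g1 * g2 * g3) ∈ M := m 6
  have sq (a g b : F3) := leftTrans_sq_mem (M := M) (a := a) (g := g) (b := b)
  have swap (a g h b : F3) :=
    leftTrans_swap_mem (M := M) (a := a) (g := g) (h := h) (b := b)
  have m11 : leftTrans ℂ (g1 * g1) ∈ M := by simpa using sq 1 g1 1 a1 (by simpa) (by simpa)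
  have m112 : leftTrans ℂ (g1 * g1 * g2) ∈ M := by
    simpa using sq 1 g1 g2 a1 (by simpa) (by simpa)
  have m113 : leftTrans ℂ (g1 * g1 * g3) ∈ M := by
    simpa using sq 1 g1 g3 a1 (by simpa) (by simpa)
  have m1123 : leftTrans ℂ (g1 * g1 * g2 * g3) ∈ M := by
    simpa [mul_assoc] using sq 1 g1 (g2 * g3) a1 (by simpa [mul_assoc] using m123) (by simpa)
  have m22 : leftTrans ℂ (g2 * g2) ∈ M := by simpa using sq 1 g2 1 a2 (by simpa) (by simpa)
  have m223 : leftTrans ℂ (g2 * g2 * g3) ∈ M := by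
    simpa using sq 1 g2 g3 a2 (by simpa) (by simpa)
  have m122 : leftTrans ℂ (g1 * g2 * g2) ∈ M := by
    simpa using sq g1 g2 1 a2 (by simpa) (by simpa)
  have m1223 : leftTrans ℂ (g1 * g2 * g2 * g3) ∈ M := sq g1 g2 g3 a2 m123 m13
  have m21 : leftTrans ℂ (g2 * g1) ∈ M := by
    simpa using swap 1 g1 g2 1 a1 a2 a12 (by simpa) (by simpa) (by simpa) (by simpa)
  have m212 : leftTrans ℂ (g2 * g1 * g2) ∈ M := by
    simpa using swap 1 g1 g2 g2 a1 a2 a12 (by simpa) (by simpa) (by simpa) (by simpa)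
  have m213 : leftTrans ℂ (g2 * g1 * g3) ∈ M := by
    simpa using swap 1 g1 g2 g3 a1 a2 a12 (by simpa) (by simpa) (by simpa) (by simpa)
  have m2123 : leftTrans ℂ (g2 * g1 * g2 * g3) ∈ M := by
    simpa [mul_assoc] using swap 1 g1 g2 (g2 * g3) a1 a2 a12
      (by simpa [mul_assoc] using m1223) (by simpa [mul_assoc] using m123)
      (by simpa [mul_assoc] using m223) (by simpa)
  have m33 : leftTrans ℂ (g3 * g3) ∈ M := by simpa using sq 1 g3 1 a3 (by simpa) (by simpa)
  have m133 : leftTrans ℂ (g1 * g3 * g3) ∈ M := by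
    simpa using sq g1 g3 1 a3 (by simpa) (by simpa)
  have m233 : leftTrans ℂ (g2 * g3 * g3) ∈ M := by
    simpa using sq g2 g3 1 a3 (by simpa) (by simpa)
  have m1233 : leftTrans ℂ (g1 * g2 * g3 * g3) ∈ M := by
    simpa using sq (g1 * g2) g3 1 a3 (by simpa) (by simpa)
  have m31 : leftTrans ℂ (g3 * g1) ∈ M := by
    simpa using swap 1 g1 g3 1 a1 a3 a13 (by simpa) (by simpa) (by simpa) (by simpa)
  have m313 : leftTrans ℂ (g3 * g1 * g3) ∈ M := by
    simpa using swap 1 g1 g3 g3 a1 a3 a13 (by simpa) (by simpa) (by simpa) (by simpa)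
  have m32 : leftTrans ℂ (g3 * g2) ∈ M := by
    simpa using swap 1 g2 g3 1 a2 a3 a23 (by simpa) (by simpa) (by simpa) (by simpa)
  have m323 : leftTrans ℂ (g3 * g2 * g3) ∈ M := by
    simpa using swap 1 g2 g3 g3 a2 a3 a23 (by simpa) (by simpa) (by simpa) (by simpa)
  have m132 : leftTrans ℂ (g1 * g3 * g2) ∈ M := by
    simpa using swap g1 g2 g3 1 a2 a3 a23 (by simpa) (by simpa) (by simpa) (by simpa)
  have m1323 : leftTrans ℂ (g1 * g3 * g2 * g3) ∈ M :=
    swap g1 g2 g3 g3 a2 a3 a23 m1233 m123 m133 m13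
  have m312 : leftTrans ℂ (g3 * g1 * g2) ∈ M := by
    simpa using swap 1 g1 g3 g2 a1 a3 a13 (by simpa) (by simpa) (by simpa) (by simpa)
  have m3123 : leftTrans ℂ (g3 * g1 * g2 * g3) ∈ M := by
    simpa [mul_assoc] using swap 1 g1 g3 (g2 * g3) a1 a3 a13
      (by simpa [mul_assoc] using m1323) (by simpa [mul_assoc] using m123)
      (by simpa [mul_assoc] using m323) (by simpa)
  have key (i : Fin 3) {v : F3} (hv : leftTrans ℂ v ∈ M) :
      leftTrans ℂ (FreeGroup.of i * v) ∈ M := by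
    refine leftTrans_mul_mem ?_ hv
    rintro _ (rfl | ⟨j, rfl⟩)
    · rw [mul_one]
      fin_cases i
      exacts [m1, m2, m3]
    · rw [← hM]
      fin_cases i
      · change leftTrans ℂ (g1 * word j) ∈ M
        fin_cases j <;> simpa [word, ← mul_assoc]
      · change leftTrans ℂ (g2 * word j) ∈ M
        fin_cases j <;> simpa [word, ← mul_assoc]
      · change leftTrans ℂ (g3 * word j) ∈ M
        fin_cases j <;> simpa [word, ← mul_assoc]
  have gen (i : Fin 3) : cl ℂ (FreeGroup.of i) ∈ A := by
    fin_cases i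
    exacts [a1, a2, a3]
  suffices h : ∀ v, leftTrans ℂ v ∈ M → leftTrans ℂ (w * v) ∈ M by simpa using h 1 m0
  induction w using FreeGroup.induction_on with
  | C1 => simp
  | of i => exact fun v hv => key i hv
  | inv_of i _ => exact fun v hv => leftTrans_inv_mem (gen i) (key i hv) hv
  | mul u u' hu hu' => exact fun v hv => mul_assoc u u' v ▸ hu _ (hu' _ hv)

theorem exists_Phi_eq_cl (w : F3) : ∃ P, Phi P = cl ℂ w := by
  have hA (i : Fin 7) : cl ℂ (word i) ∈ Phi.range := ⟨X i, by simp [Phi]⟩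
  have h := leftTrans_mem_span_word hA w
  let ev : (F3 → SkeinAlgebra ℂ F3) →ₗ[Phi.range] SkeinAlgebra ℂ F3 := LinearMap.proj 1
  have hev (v : F3) : ev (leftTrans ℂ v) = cl ℂ v := by simp [ev, leftTrans]
  have hle : (Submodule.span Phi.range (leftTrans ℂ '' insert 1 (Set.range word))).map ev ≤
      Subalgebra.toSubmodule (⊥ : Subalgebra Phi.range (SkeinAlgebra ℂ F3)) := by
    refine (Submodule.map_span_le _ _ _).2 ?_
    rintro _ ⟨v, hv, rfl⟩
    have hv' : cl ℂ v ∈ Phi.range := by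
      rcases hv with rfl | ⟨i, rfl⟩
      · rw [cl_one]
        exact ofNat_mem _ 2
      · exact hA i
    rw [hev]
    exact Algebra.mem_bot.2 ⟨⟨_, hv'⟩, rfl⟩
  obtain ⟨⟨_, P, hP⟩, hw⟩ := Algebra.mem_bot.1 (hle (Submodule.mem_map_of_mem h))
  rw [hev] at hw
  exact ⟨P, hP.trans hw⟩

theorem Phi_two : Phi 2 = 2 := map_ofNat Phi 2

theorem Phi_K : Phi K = 0 := by
  simpa [K, Phi, x1, x2, x3, x12, x13, x23, x123, word] using cl_triple_quadratic (R := ℂ) g1 g2 g3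

/-- Theorem 1: for a group `G` generated by three elements `g 0, g 1, g 2`,
the kernel of `Φ_G = ι ∘ Φ` is the ideal `I_G` generated by `K` together with all
differences `P - Q` of polynomials mapping under `Φ` to `[u]` and `[v]` with
`ι u = ι v`; consequently `S(G;ℂ) ≅ ℂ[x₁,…,x₁₂₃]/I_G`. -/
theorem skein_three_generators (G : Type*) [Group G] (g : Fin 3 → G)
    (hg : Subgroup.closure (Set.range g) = ⊤) :
    letI ι : F3 →* G := FreeGroup.lift g
    letI PhiG : MvPolynomial (Fin 7) ℂ →ₐ[ℂ] SkeinAlgebra ℂ G :=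
      aeval fun i => cl ℂ (ι (word i))
    letI IG : Ideal (MvPolynomial (Fin 7) ℂ) :=
      Ideal.span ({K} ∪ {p | ∃ P Q : MvPolynomial (Fin 7) ℂ, ∃ u v : F3,
        ι u = ι v ∧ Phi P = cl ℂ u ∧ Phi Q = cl ℂ v ∧ p = P - Q})
    RingHom.ker PhiG = IG ∧
      Nonempty (SkeinAlgebra ℂ G ≃ₐ[ℂ] MvPolynomial (Fin 7) ℂ ⧸ IG) := by
  let ι : F3 →* G := FreeGroup.lift g
  let PhiG : MvPolynomial (Fin 7) ℂ →ₐ[ℂ] SkeinAlgebra ℂ G :=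
    aeval fun i => cl ℂ (ι (word i))
  let IG : Ideal (MvPolynomial (Fin 7) ℂ) :=
    Ideal.span ({K} ∪ {p | ∃ P Q : MvPolynomial (Fin 7) ℂ, ∃ u v : F3,
      ι u = ι v ∧ Phi P = cl ℂ u ∧ Phi Q = cl ℂ v ∧ p = P - Q})
  change RingHom.ker PhiG = IG ∧
    Nonempty (SkeinAlgebra ℂ G ≃ₐ[ℂ] MvPolynomial (Fin 7) ℂ ⧸ IG)
  have hι : Function.Surjective ι := by
    rw [← MonoidHom.range_eq_top, FreeGroup.range_lift_eq_closure, hg]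
  -- the algebra map induced by `ι`
  let ιS : SkeinAlgebra ℂ F3 →ₐ[ℂ] SkeinAlgebra ℂ G := mapHom ι
  have hιS (w : F3) : ιS (cl ℂ w) = cl ℂ (ι w) := mapHom_cl ι w
  have hcomp (P) : PhiG P = ιS (Phi P) := by
    have : PhiG = ιS.comp Phi := by
      ext i
      simp [PhiG, Phi, hιS]
    rw [this]
    rfl
  have hIG {P Q : MvPolynomial (Fin 7) ℂ} {u v : F3} (huv : ι u = ι v) (hP : Phi P = cl ℂ u)
      (hQ : Phi Q = cl ℂ v) : Ideal.Quotient.mk IG P = Ideal.Quotient.mk IG Q :=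
    Ideal.Quotient.eq.2 (Ideal.subset_span (Or.inr ⟨P, Q, u, v, huv, hP, hQ, rfl⟩))
  have hker {P : MvPolynomial (Fin 7) ℂ} (hP : Phi P = 0) : Ideal.Quotient.mk IG P = 0 := by
    have h := hIG (P := P + 2) (Q := 2) (u := 1) (v := 1) rfl (by simp [hP, cl_one, Phi_two])
      (by simp [cl_one, Phi_two])
    simpa using h
  choose s hs using hι
  choose p hp using exists_Phi_eq_cl
  have hps {P : MvPolynomial (Fin 7) ℂ} {u : F3} (hP : Phi P = cl ℂ u) :
      Ideal.Quotient.mk IG (p (s (ι u))) = Ideal.Quotient.mk IG P := hIG (hs _) (hp _) hP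
  let Ψ : SkeinAlgebra ℂ G →ₐ[ℂ] MvPolynomial (Fin 7) ℂ ⧸ IG :=
    lift (fun h => Ideal.Quotient.mk IG (p (s h)))
      (by
        have h := hps (P := 2) (u := 1) (by rw [Phi_two, cl_one])
        rw [map_one] at h
        exact h.trans (map_ofNat (Ideal.Quotient.mk IG) 2))
      (by
        intro a b
        have h := hker (P := p (s a) * p (s b) - p (s a * s b) - p (s a * (s b)⁻¹))
          (by simp [hp, cl_mul_cl])
        have h₁ := hps (hp (s a * s b))
        have h₂ := hps (hp (s a * (s b)⁻¹))
        simp only [map_mul, map_inv, hs] at h₁ h₂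
        simp only [map_sub, map_mul] at h
        rw [h₁, h₂]
        linear_combination h)
  have hΨ (P) : Ψ (PhiG P) = Ideal.Quotient.mk IG P := by
    have : Ψ.comp PhiG = Ideal.Quotient.mkₐ ℂ IG := by
      ext i
      simpa [PhiG, Ψ, lift_cl] using hps (P := X i) (u := word i) (by simp [Phi])
    exact DFunLike.congr_fun this P
  have hsurj : Function.Surjective PhiG := by
    rw [← AlgHom.range_eq_top]
    refine eq_top_of_cl_mem fun h => ⟨p (s h), ?_⟩
    change PhiG _ = _
    rw [hcomp, hp, hιS, hs]
  have hkerPhiG : RingHom.ker PhiG = IG := by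
    refine le_antisymm (fun P hP => ?_) (Ideal.span_le.2 ?_)
    · rw [← Ideal.Quotient.eq_zero_iff_mem, ← hΨ, RingHom.mem_ker.1 hP, map_zero]
    · rintro _ (rfl | ⟨P, Q, u, v, huv, hP, hQ, rfl⟩)
      · rw [SetLike.mem_coe, RingHom.mem_ker, hcomp, Phi_K, map_zero]
      · rw [SetLike.mem_coe, RingHom.mem_ker, map_sub, hcomp, hcomp, hP, hQ, hιS, hιS, huv,
          sub_self]
  exact ⟨hkerPhiG, ⟨((Ideal.quotientEquivAlgOfEq ℂ hkerPhiG.symm).trans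
    (Ideal.quotientKerAlgEquivOfSurjective hsurj)).symm⟩⟩
end
end

section
/- Let α, β, γ, δ ∈ F₃ and let Ī be the ideal of ℂ[x₁, x₂, x₃, x₁₂, x₁₃, x₂₃, x₁₂₃] generated by K together with fixed polynomials P_{αg} − P_{βg} and P_{γg} − P_{δg} for g = g₁^{i₁}g₂^{i₂}g₃^{i₃}, 0 ≤ i₁, i₂, i₃ ≤ 1, where Φ(P_w) = [w] for each such word w. Then for every g ∈ F₃ and every choice of polynomials P_{αg}, P_{βg}, P_{γg}, P_{δg} with Φ(P_{αg}) = [αg], Φ(P_{βg}) = [βg], Φ(P_{γg}) = [γg], Φ(P_{δg}) = [δg], one has P_{αg} − P_{βg} ∈ Ī and P_{γg} − P_{δg} ∈ Ī. -/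
open MvPolynomial

noncomputable section

/-- `g = g₁^{i₁} g₂^{i₂} g₃^{i₃}` with `0 ≤ i₁, i₂, i₃ ≤ 1`. -/
def gpow (i : Fin 2 × Fin 2 × Fin 2) : F3 :=
  g1 ^ (i.1 : ℕ) * g2 ^ (i.2.1 : ℕ) * g3 ^ (i.2.2 : ℕ)

open scoped MatrixGroups

section SkeinRelations

variable {R G : Type*} [CommRing R] [Group G]

theorem cl_one : cl R (1 : G) = 2 := by
  have h : X (1 : G) - 2 ∈ skeinIdeal R G := Ideal.subset_span (Or.inl rfl)
  exact (Ideal.Quotient.eq.mpr h).trans (map_ofNat _ 2)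

theorem cl_mul_cl (g h : G) : cl R g * cl R h = cl R (g * h) + cl R (g * h⁻¹) := by
  have key : X g * X h - (X (g * h) + X (g * h⁻¹)) ∈ skeinIdeal R G :=
    Ideal.subset_span (Or.inr ⟨g, h, by ring⟩)
  simpa [cl] using Ideal.Quotient.eq.mpr key

theorem cl_inv (g : G) : cl R g⁻¹ = cl R g := by
  have h := cl_mul_cl (R := R) 1 g
  rw [cl_one, one_mul, one_mul] at h
  linear_combination -h

theorem cl_mul_comm (g h : G) : cl R (g * h) = cl R (h * g) := by
  have h₁ := cl_mul_cl (R := R) g h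
  have h₂ := cl_mul_cl (R := R) h g
  have h₃ := cl_inv (R := R) (g * h⁻¹)
  rw [mul_inv_rev, inv_inv] at h₃
  linear_combination h₂ - h₁ + h₃

theorem cl_insert_add_cl_insert_inv (g h k : G) :
    cl R (g * h * k) + cl R (g * h⁻¹ * k) = cl R h * cl R (g * k) := by
  rw [cl_mul_comm (g * h), cl_mul_comm (g * h⁻¹), cl_mul_comm g k, mul_comm (cl R h), cl_mul_cl]
  simp only [mul_assoc]

end SkeinRelations

/-- The trace identity `tr A tr B = tr AB + tr AB⁻¹` in `SL₂`. -/
theorem trace_mul_trace_SL2 {R : Type*} [CommRing R] (A B : SL(2, R)) :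
    A.1.trace * B.1.trace = (A * B).1.trace + (A * B⁻¹).1.trace := by
  simp only [Matrix.SpecialLinearGroup.coe_mul, Matrix.SpecialLinearGroup.coe_inv,
    Matrix.adjugate_fin_two, Matrix.trace_fin_two, Matrix.mul_apply, Fin.sum_univ_two,
    Matrix.of_apply, Matrix.cons_val_zero, Matrix.cons_val_one, Matrix.cons_val',
    Matrix.cons_val_fin_one]
  ring

/-- The character of a representation in `SL₂`, as an algebra homomorphism on the skein algebra. -/
def characterHom {R G : Type*} [CommRing R] [Group G] (ρ : G →* SL(2, R)) :
    SkeinAlgebra R G →ₐ[R] R :=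
  Ideal.Quotient.liftₐ (skeinIdeal R G) (aeval fun g => (ρ g).1.trace) fun p hp => by
    rw [← RingHom.mem_ker]
    refine (Ideal.span_le (I := RingHom.ker _)).mpr ?_ hp
    rintro _ (rfl | ⟨g, h, rfl⟩)
    · simp [Matrix.trace_fin_two, RingHom.mem_ker, one_add_one_eq_two]
    · have := trace_mul_trace_SL2 (ρ g) (ρ h)
      simp only [SetLike.mem_coe, RingHom.mem_ker, map_sub, map_mul, aeval_X, map_inv]
      linear_combination this

@[simp]
theorem characterHom_cl {R G : Type*} [CommRing R] [Group G] (ρ : G →* SL(2, R)) (g : G) :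
    characterHom ρ (cl R g) = (ρ g).1.trace := by
  simp [characterHom, cl]

theorem characterHom_Phi (ρ : F3 →* SL(2, ℂ)) (P : MvPolynomial (Fin 7) ℂ) :
    characterHom ρ (Phi P) = eval (fun i => (ρ (word i)).1.trace) P := by
  have : (characterHom ρ).comp Phi = aeval fun i => (ρ (word i)).1.trace := by
    ext i
    simp [Phi]
  simpa [aeval_eq_eval] using DFunLike.congr_fun this P

/-- The sum of the two roots of `K`, viewed as a quadratic polynomial in `x₁₂₃`. -/
def rootSum : MvPolynomial (Fin 6) ℂ := X 3 * X 2 + X 4 * X 1 + X 5 * X 0 - X 0 * X 1 * X 2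

/-- The product of the two roots of `K`, viewed as a quadratic polynomial in `x₁₂₃`. -/
def rootProd : MvPolynomial (Fin 6) ℂ :=
  X 0 ^ 2 + X 1 ^ 2 + X 2 ^ 2 + X 3 ^ 2 + X 5 ^ 2 + X 4 ^ 2
    - X 0 * X 1 * X 3 - X 0 * X 2 * X 4 - X 1 * X 2 * X 5 + X 3 * X 4 * X 5 - 4

theorem K_eq : K = X (Fin.last 6) ^ 2 - rename Fin.castSucc rootSum * X (Fin.last 6)
    + rename Fin.castSucc rootProd := by
  simp only [K, x1, x2, x3, x12, x13, x23, x123, rootSum, rootProd, map_add, map_sub, map_mul,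
    map_pow, rename_X, map_ofNat]
  simp only [show Fin.last 6 = (6 : Fin 7) from rfl, show Fin.castSucc (0 : Fin 6) = 0 from rfl,
    show Fin.castSucc (1 : Fin 6) = 1 from rfl, show Fin.castSucc (2 : Fin 6) = 2 from rfl,
    show Fin.castSucc (3 : Fin 6) = 3 from rfl, show Fin.castSucc (4 : Fin 6) = 4 from rfl,
    show Fin.castSucc (5 : Fin 6) = 5 from rfl]
  ring

/-- Every polynomial is congruent modulo `K` to one of degree at most one in `x₁₂₃`. -/
theorem exists_sub_linear_mem_span_K (P : MvPolynomial (Fin 7) ℂ) :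
    ∃ a b : MvPolynomial (Fin 6) ℂ,
      P - (rename Fin.castSucc a + rename Fin.castSucc b * X (Fin.last 6)) ∈ Ideal.span {K} := by
  simp only [Ideal.mem_span_singleton']
  induction P using MvPolynomial.induction_on with
  | C c => exact ⟨C c, 0, 0, by simp⟩
  | add P Q hP hQ =>
    obtain ⟨a, b, s, hs⟩ := hP
    obtain ⟨a', b', s', hs'⟩ := hQ
    refine ⟨a + a', b + b', s + s', ?_⟩
    simp only [map_add]
    linear_combination hs + hs'
  | mul_X P i hP =>
    obtain ⟨a, b, s, hs⟩ := hP
    induction i using Fin.lastCases with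
    | last =>
      refine ⟨-(b * rootProd), a + b * rootSum, s * X (Fin.last 6) + rename Fin.castSucc b, ?_⟩
      simp only [map_add, map_neg, map_mul]
      linear_combination X (Fin.last 6) * hs + rename Fin.castSucc b * K_eq
    | cast i =>
      refine ⟨a * X i, b * X i, s * X i.castSucc, ?_⟩
      simp only [map_mul, rename_X]
      linear_combination X i.castSucc * hs

/-- Elements of `SL₂(ℂ)` with prescribed traces of `A, B, C, AB, AC, BC, ABC`. -/
theorem exists_SL2_traces {y₁ y₂ y₃ y₁₂ y₁₃ y₂₃ t : ℂ} (h₁ : y₁ ^ 2 - 4 ≠ 0)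
    (h₂ : y₁ ^ 2 + y₂ ^ 2 + y₁₂ ^ 2 - y₁ * y₂ * y₁₂ - 4 ≠ 0)
    (hK : t ^ 2 - (y₁₂ * y₃ + y₁₃ * y₂ + y₂₃ * y₁ - y₁ * y₂ * y₃) * t
      + (y₁ ^ 2 + y₂ ^ 2 + y₃ ^ 2 + y₁₂ ^ 2 + y₂₃ ^ 2 + y₁₃ ^ 2
      - y₁ * y₂ * y₁₂ - y₁ * y₃ * y₁₃ - y₂ * y₃ * y₂₃ + y₁₂ * y₁₃ * y₂₃ - 4) = 0) :
    ∃ A B C : SL(2, ℂ), A.1.trace = y₁ ∧ B.1.trace = y₂ ∧ C.1.trace = y₃ ∧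
      (A * B).1.trace = y₁₂ ∧ (A * C).1.trace = y₁₃ ∧ (B * C).1.trace = y₂₃ ∧
      (A * B * C).1.trace = t := by
  obtain ⟨d, hd⟩ := IsAlgClosed.exists_pow_nat_eq (y₁ ^ 2 - 4) two_pos
  have hd0 : d ≠ 0 := by
    rintro rfl
    exact h₁ (by simpa using hd.symm)
  obtain ⟨a, b, hab, hy₁, hdab⟩ : ∃ a b : ℂ, a * b = 1 ∧ y₁ = a + b ∧ d = a - b :=
    ⟨(y₁ + d) / 2, (y₁ - d) / 2, by linear_combination -hd / 4, by ring, by ring⟩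
  have solve (e f : ℂ) : ∃ p q : ℂ, e = p + q ∧ f = a * p + b * q := by
    refine ⟨(f - b * e) / d, (a * e - f) / d, ?_, ?_⟩
    · field_simp
      linear_combination e * hdab
    · field_simp
      linear_combination f * hdab
  obtain ⟨p, q, rfl, rfl⟩ := solve y₂ y₁₂
  obtain ⟨r, v, rfl, rfl⟩ := solve y₃ y₁₃
  obtain ⟨u, w, hu, hw⟩ := solve (y₂₃ - p * r - q * v) (t - a * p * r - b * q * v)
  obtain rfl : y₂₃ = u + w + p * r + q * v := by linear_combination hu
  obtain rfl : t = a * u + b * w + a * p * r + b * q * v := by linear_combination hw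
  subst hy₁ hdab
  have hm : p * q - 1 ≠ 0 := fun h => h₂ (by grind)
  have huw : u * w = (p * q - 1) * (r * v - 1) := by
    have : (a - b) ^ 2 * (u * w - (p * q - 1) * (r * v - 1)) = 0 := by grind
    simpa [hd0, sub_eq_zero] using this
  obtain ⟨A, hA⟩ : ∃ A : SL(2, ℂ), A.1 = !![a, 0; 0, b] :=
    ⟨⟨_, by simp [hab]⟩, rfl⟩
  obtain ⟨B, hB⟩ : ∃ B : SL(2, ℂ), B.1 = !![p, 1; p * q - 1, q] :=
    ⟨⟨_, by simp [Matrix.det_fin_two]⟩, rfl⟩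
  obtain ⟨C, hC⟩ : ∃ C : SL(2, ℂ), C.1 = !![r, w / (p * q - 1); u, v] := by
    refine ⟨⟨_, ?_⟩, rfl⟩
    rw [Matrix.det_fin_two_of]
    field_simp
    linear_combination -huw
  refine ⟨A, B, C, ?_⟩
  simp only [Matrix.SpecialLinearGroup.coe_mul, hA, hB, hC, Matrix.mul_fin_two,
    Matrix.trace_fin_two_of, true_and]
  refine ⟨by ring, by ring, ?_, ?_⟩ <;> field_simp <;> ring

theorem eval_eq_zero_of_Phi_eq_zero {P : MvPolynomial (Fin 7) ℂ} (hP : Phi P = 0)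
    {y : Fin 6 → ℂ} {t : ℂ} (h₁ : y 0 ^ 2 - 4 ≠ 0)
    (h₂ : y 0 ^ 2 + y 1 ^ 2 + y 3 ^ 2 - y 0 * y 1 * y 3 - 4 ≠ 0)
    (hK : t ^ 2 - eval y rootSum * t + eval y rootProd = 0) :
    eval (Fin.snoc y t : Fin 7 → ℂ) P = 0 := by
  obtain ⟨A, B, C, hA, hB, hC, hAB, hAC, hBC, hABC⟩ :=
    exists_SL2_traces (y₃ := y 2) (y₁₃ := y 4) (y₂₃ := y 5) (t := t) h₁ h₂
      (by simpa [rootSum, rootProd] using hK)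
  have h := characterHom_Phi (FreeGroup.lift ![A, B, C]) P
  rw [hP, map_zero] at h
  rw [h]
  congr 2
  funext i
  fin_cases i
  · exact hA.symm.trans (by simp [word, g1])
  · exact hB.symm.trans (by simp [word, g2])
  · exact hC.symm.trans (by simp [word, g3])
  · exact hAB.symm.trans (by simp [word, g1, g2])
  · exact hAC.symm.trans (by simp [word, g1, g3])
  · exact hBC.symm.trans (by simp [word, g2, g3])
  · exact hABC.symm.trans (by simp [word, g1, g2, g3])

/-- The kernel of `Φ` is contained in the ideal generated by `K`. -/
theorem mem_span_K_of_Phi_eq_zero {P : MvPolynomial (Fin 7) ℂ} (hP : Phi P = 0) :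
    P ∈ Ideal.span {K} := by
  obtain ⟨a, b, hab⟩ := exists_sub_linear_mem_span_K P
  let nondeg : MvPolynomial (Fin 6) ℂ :=
    (X 0 ^ 2 - 4) * (X 0 ^ 2 + X 1 ^ 2 + X 3 ^ 2 - X 0 * X 1 * X 3 - 4) *
      (rootSum ^ 2 - 4 * rootProd)
  have h_nondeg : nondeg ≠ 0 := fun h => by
    have := congrArg (eval fun _ => 0) h
    simp only [nondeg, rootSum, rootProd, map_add, map_sub, map_mul, map_pow, map_ofNat, map_zero,
      eval_X] at this
    norm_num at this
  have h_eval (y : Fin 6 → ℂ) (hy : eval y nondeg ≠ 0) : eval y a = 0 ∧ eval y b = 0 := by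
    simp only [nondeg, map_mul, mul_ne_zero_iff] at hy
    obtain ⟨⟨h₁, h₂⟩, h₃⟩ := hy
    have linear {t : ℂ} (ht : t ^ 2 - eval y rootSum * t + eval y rootProd = 0) :
        eval y a + eval y b * t = 0 := by
      obtain ⟨s, hs⟩ := Ideal.mem_span_singleton'.mp hab
      have := congrArg (eval (Fin.snoc y t : Fin 7 → ℂ)) hs
      have hcomp : (Fin.snoc y t : Fin 7 → ℂ) ∘ Fin.castSucc = y := by
        funext i
        simp
      simp only [K_eq, map_add, map_sub, map_mul, map_pow, eval_rename, hcomp, eval_X,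
        Fin.snoc_last, ht, mul_zero, eval_eq_zero_of_Phi_eq_zero hP (by simpa using h₁)
        (by simpa using h₂) ht] at this
      linear_combination this
    obtain ⟨e, he⟩ := IsAlgClosed.exists_pow_nat_eq (eval y (rootSum ^ 2 - 4 * rootProd)) two_pos
    have he0 : e ≠ 0 := by
      rintro rfl
      exact h₃ (by simpa using he.symm)
    simp only [map_sub, map_mul, map_pow, map_ofNat] at he
    have hp := linear (t := (eval y rootSum + e) / 2) (by linear_combination he / 4)
    have hm := linear (t := (eval y rootSum - e) / 2) (by linear_combination he / 4)
    have hb : eval y b = 0 := by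
      have : e * eval y b = 0 := by linear_combination hp - hm
      simpa [he0] using this
    exact ⟨by simpa [hb] using hp, hb⟩
  have eq_zero (c : MvPolynomial (Fin 6) ℂ) (hc : ∀ y, eval y nondeg ≠ 0 → eval y c = 0) :
      c = 0 := by
    have : nondeg * c = 0 := MvPolynomial.funext fun y => by
      by_cases hy : eval y nondeg = 0
      · simp [hy]
      · simp [hc y hy]
    exact (mul_eq_zero.mp this).resolve_left h_nondeg
  rw [eq_zero a fun y hy => (h_eval y hy).1, eq_zero b fun y hy => (h_eval y hy).2] at hab
  simpa using hab

/-- `f` satisfies the relation `f (g h k) + f (g h⁻¹ k) = [h] f (g k)`, i.e. its linear extension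
factors through the quotient of the group ring by the relations `h + h⁻¹ = [h]`. -/
def IsSkeinLinear {R G : Type*} [CommRing R] [Group G] (f : G → SkeinAlgebra R G) : Prop :=
  ∀ g h k : G, f (g * h * k) + f (g * h⁻¹ * k) = cl R h * f (g * k)

namespace IsSkeinLinear

section

variable {R G : Type*} [CommRing R] [Group G] {f : G → SkeinAlgebra R G}

theorem cl_sub (α β : G) : IsSkeinLinear fun g => cl R (α * g) - cl R (β * g) := by
  intro g h k
  have h₁ := cl_insert_add_cl_insert_inv (R := R) (α * g) h k
  have h₂ := cl_insert_add_cl_insert_inv (R := R) (β * g) h k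
  simp only [mul_assoc] at h₁ h₂ ⊢
  linear_combination h₁ - h₂

theorem comp_mul_right (hf : IsSkeinLinear f) (x : G) : IsSkeinLinear fun g => f (g * x) := by
  intro g h k
  simpa only [mul_assoc] using hf g h (k * x)

theorem pow_mem (hf : IsSkeinLinear f) {J : AddSubgroup (SkeinAlgebra R G)} {x : G}
    (hx : ∀ a ∈ J, cl R x * a ∈ J) {g k : G} (h₀ : f (g * k) ∈ J) (h₁ : f (g * x * k) ∈ J)
    (n : ℕ) : f (g * x ^ n * k) ∈ J := by
  induction n using Nat.twoStepInduction with
  | zero => simpa using h₀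
  | one => simpa using h₁
  | more n ih₀ ih₁ =>
    have h := hf (g * x ^ (n + 1)) x k
    rw [mul_assoc g _ x, ← pow_succ, mul_assoc g _ x⁻¹, pow_succ x n, mul_inv_cancel_right,
      ← pow_succ] at h
    rw [eq_sub_of_add_eq h]
    exact J.sub_mem (hx _ ih₁) ih₀

theorem swap_mem (hf : IsSkeinLinear f) {J : AddSubgroup (SkeinAlgebra R G)} {x y : G}
    (hx : ∀ a ∈ J, cl R x * a ∈ J) (hy : ∀ a ∈ J, cl R y * a ∈ J)
    (hxy : ∀ a ∈ J, cl R (x * y) * a ∈ J) {g k : G} (h : f (g * k) ∈ J) (h_x : f (g * x * k) ∈ J)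
    (h_y : f (g * y * k) ∈ J) (h_xy : f (g * x * y * k) ∈ J) : f (g * y * x * k) ∈ J := by
  have h₁ := hf g (y * x) k
  have h₂ := hf g x (y⁻¹ * k)
  have h₃ := hf g y k
  have h₄ := hf (g * x) y k
  rw [cl_mul_comm y x] at h₁
  simp only [mul_inv_rev, mul_assoc] at *
  have : f (g * (y * (x * k))) = cl R (x * y) * f (g * k) - cl R x * (cl R y * f (g * k))
      + cl R x * f (g * (y * k)) + cl R y * f (g * (x * k)) - f (g * (x * (y * k))) := by
    linear_combination h₁ - h₂ - cl R x * h₃ + h₄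
  rw [this]
  exact J.sub_mem (J.add_mem (J.add_mem (J.sub_mem (hxy _ h) (hx _ (hy _ h))) (hx _ h_y))
    (hy _ h_x)) h_xy

end

variable {f : F3 → SkeinAlgebra ℂ F3} {J : AddSubgroup (SkeinAlgebra ℂ F3)}

theorem ordered_mem (hf : IsSkeinLinear f) (hJ : ∀ i, ∀ a ∈ J, cl ℂ (word i) * a ∈ J)
    (h : ∀ i, f (gpow i) ∈ J) (i j k : ℕ) : f (g1 ^ i * g2 ^ j * g3 ^ k) ∈ J := by
  have step₁ (j k : Fin 2) (i : ℕ) : f (1 * g1 ^ i * (g2 ^ (j : ℕ) * g3 ^ (k : ℕ))) ∈ J := by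
    refine hf.pow_mem (x := g1) (hJ 0) ?_ ?_ i
    · simpa [gpow] using h (0, j, k)
    · simpa [gpow, mul_assoc] using h (1, j, k)
  have step₂ (k : Fin 2) (i j : ℕ) : f (g1 ^ i * g2 ^ j * g3 ^ (k : ℕ)) ∈ J := by
    refine hf.pow_mem (x := g2) (hJ 1) ?_ ?_ j
    · simpa using step₁ 0 k i
    · simpa [mul_assoc] using step₁ 1 k i
  have step₃ : f (g1 ^ i * g2 ^ j * g3 ^ k * 1) ∈ J := by
    refine hf.pow_mem (x := g3) (hJ 2) ?_ ?_ k
    · simpa using step₂ 0 i j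
    · simpa using step₂ 1 i j
  simpa using step₃

theorem gpow_mul_of_mem (hf : IsSkeinLinear f) (hJ : ∀ i, ∀ a ∈ J, cl ℂ (word i) * a ∈ J)
    (h : ∀ i, f (gpow i) ∈ J) (x : Fin 3) (i : Fin 2 × Fin 2 × Fin 2) :
    f (gpow i * FreeGroup.of x) ∈ J := by
  have M := hf.ordered_mem hJ h
  obtain ⟨i, j, k⟩ := i
  fin_cases x
  · have h₂₁ (k : ℕ) : f (g1 ^ (i : ℕ) * g2 * g1 * g3 ^ k) ∈ J := by
      refine hf.swap_mem (x := g1) (y := g2) (hJ 0) (hJ 1) (hJ 3) ?_ ?_ ?_ ?_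
      · simpa using M i 0 k
      · simpa [pow_succ] using M (i + 1) 0 k
      · simpa using M i 1 k
      · simpa [pow_succ] using M (i + 1) 1 k
    have h₃₁ : f (g1 ^ (i : ℕ) * g3 * g1 * 1) ∈ J := by
      refine hf.swap_mem (x := g1) (y := g3) (hJ 0) (hJ 2) (hJ 4) ?_ ?_ ?_ ?_
      · simpa using M i 0 0
      · simpa [pow_succ] using M (i + 1) 0 0
      · simpa using M i 0 1
      · simpa [pow_succ] using M (i + 1) 0 1
    have h₂₃₁ : f (g1 ^ (i : ℕ) * g2 * g3 * g1 * 1) ∈ J := by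
      refine hf.swap_mem (x := g1) (y := g3) (hJ 0) (hJ 2) (hJ 4) ?_ ?_ ?_ ?_
      · simpa using M i 1 0
      · simpa using h₂₁ 0
      · simpa using M i 1 1
      · simpa using h₂₁ 1
    fin_cases j <;> fin_cases k
    · simpa [gpow, g1, pow_succ] using M (i + 1) 0 0
    · simpa [gpow, g1] using h₃₁
    · simpa [gpow, g1] using h₂₁ 0
    · simpa [gpow, g1] using h₂₃₁
  · fin_cases k
    · simpa [gpow, g2, pow_succ, mul_assoc] using M i (j + 1) 0
    · have : f (g1 ^ (i : ℕ) * g2 ^ (j : ℕ) * g3 * g2 * 1) ∈ J := by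
        refine hf.swap_mem (x := g2) (y := g3) (hJ 1) (hJ 2) (hJ 5) ?_ ?_ ?_ ?_
        · simpa using M i j 0
        · simpa [pow_succ, mul_assoc] using M i (j + 1) 0
        · simpa using M i j 1
        · simpa [pow_succ, mul_assoc] using M i (j + 1) 1
      simpa [gpow, g2] using this
  · simpa [gpow, g3, pow_succ, mul_assoc] using M i j (k + 1)

theorem gpow_mul_mem (hf : IsSkeinLinear f) (hJ : ∀ i, ∀ a ∈ J, cl ℂ (word i) * a ∈ J)
    (h : ∀ i, f (gpow i) ∈ J) (w : F3) (i : Fin 2 × Fin 2 × Fin 2) : f (gpow i * w) ∈ J := by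
  induction w using FreeGroup.induction_on generalizing f i with
  | C1 => simpa using h i
  | of x => exact hf.gpow_mul_of_mem hJ h x i
  | inv_of x ih =>
    have key := hf (gpow i) (FreeGroup.of x) 1
    simp only [mul_one] at key
    rw [eq_sub_of_add_eq' key]
    refine J.sub_mem ?_ (ih hf h i)
    fin_cases x
    exacts [hJ 0 _ (h i), hJ 1 _ (h i), hJ 2 _ (h i)]
  | mul v w hv hw =>
    simpa only [mul_assoc] using hv (hf.comp_mul_right w) (hw hf h) i

theorem mem (hf : IsSkeinLinear f) (hJ : ∀ i, ∀ a ∈ J, cl ℂ (word i) * a ∈ J)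
    (h : ∀ i, f (gpow i) ∈ J) (w : F3) : f w ∈ J := by
  simpa [gpow] using hf.gpow_mul_mem hJ h w (0, 0, 0)

end IsSkeinLinear

theorem sub_mem_of_gpow_sub_mem {I : Ideal (MvPolynomial (Fin 7) ℂ)} (hK : K ∈ I) {α β : F3}
    {Pa Pb : Fin 2 × Fin 2 × Fin 2 → MvPolynomial (Fin 7) ℂ}
    (hPa : ∀ i, Phi (Pa i) = cl ℂ (α * gpow i)) (hPb : ∀ i, Phi (Pb i) = cl ℂ (β * gpow i))
    (hI : ∀ i, Pa i - Pb i ∈ I) {g : F3} {Pag Pbg : MvPolynomial (Fin 7) ℂ}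
    (hag : Phi Pag = cl ℂ (α * g)) (hbg : Phi Pbg = cl ℂ (β * g)) : Pag - Pbg ∈ I := by
  obtain ⟨q, hq, hqg⟩ : cl ℂ (α * g) - cl ℂ (β * g) ∈
      I.toAddSubgroup.map (Phi : MvPolynomial (Fin 7) ℂ →+ SkeinAlgebra ℂ F3) := by
    refine (IsSkeinLinear.cl_sub α β).mem ?_ ?_ g
    · rintro i _ ⟨p, hp, rfl⟩
      exact ⟨X i * p, I.mul_mem_left _ hp, by simp [Phi]⟩
    · intro i
      exact ⟨Pa i - Pb i, hI i, by simp [hPa, hPb]⟩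
  have hker : Phi (Pag - Pbg - q) = 0 := by
    rw [map_sub, map_sub, hag, hbg, ← hqg]
    exact sub_self _
  have h_mem : Pag - Pbg - q ∈ I :=
    (Ideal.span_singleton_le_iff_mem I).mpr hK (mem_span_K_of_Phi_eq_zero hker)
  simpa using I.add_mem h_mem hq

/-- Lemma 2.4: with `Ī` the ideal generated by `K` and the fixed difference
polynomials `P_{αg} - P_{βg}`, `P_{γg} - P_{δg}` for `g = g₁^{i₁}g₂^{i₂}g₃^{i₃}`,
`0 ≤ i₁,i₂,i₃ ≤ 1`, every difference `P_{αg} - P_{βg}` and `P_{γg} - P_{δg}` for an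
arbitrary `g ∈ F₃` lies in `Ī`. -/
theorem skein_differences_mem (α β γ δ : F3)
    (Pa Pb Pc Pd : Fin 2 × Fin 2 × Fin 2 → MvPolynomial (Fin 7) ℂ)
    (hPa : ∀ i, Phi (Pa i) = cl ℂ (α * gpow i))
    (hPb : ∀ i, Phi (Pb i) = cl ℂ (β * gpow i))
    (hPc : ∀ i, Phi (Pc i) = cl ℂ (γ * gpow i))
    (hPd : ∀ i, Phi (Pd i) = cl ℂ (δ * gpow i)) :
    letI Ibar : Ideal (MvPolynomial (Fin 7) ℂ) :=
      Ideal.span ({K} ∪ Set.range (fun i => Pa i - Pb i) ∪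
        Set.range (fun i => Pc i - Pd i))
    ∀ g : F3, ∀ Pag Pbg Pcg Pdg : MvPolynomial (Fin 7) ℂ,
      Phi Pag = cl ℂ (α * g) → Phi Pbg = cl ℂ (β * g) →
      Phi Pcg = cl ℂ (γ * g) → Phi Pdg = cl ℂ (δ * g) →
      Pag - Pbg ∈ Ibar ∧ Pcg - Pdg ∈ Ibar := by
  intro g Pag Pbg Pcg Pdg ha hb hc hd
  exact ⟨sub_mem_of_gpow_sub_mem (Ideal.subset_span (Or.inl (Or.inl rfl))) hPa hPb
      (fun i => Ideal.subset_span (Or.inl (Or.inr ⟨i, rfl⟩))) ha hb,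
    sub_mem_of_gpow_sub_mem (Ideal.subset_span (Or.inl (Or.inl rfl))) hPc hPd
      (fun i => Ideal.subset_span (Or.inr ⟨i, rfl⟩)) hc hd⟩
end
end
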